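/- Let F be a cdf with density f twice differentiable with bounded continuous second derivative, and let k be a symmetric probability density with compact support and k₂ = ∫v²k(v)dv. Then the variance of A(x) = K(h⁻¹(x − X)) − 1{X ≤ x}, X ~ F, satisfies Var A(x) = 2(e₁ − d₁) h f(x) + O(h²) as h → 0+, where e₁ = ∫₀^∞ v k(v) dv and d₁ = ∫ v k(v) K(v) dv. -/

import Mathlib

open MeasureTheory Set

/-- Integration by parts for the square of an indefinite Lebesgue integral. -/
lemma intervalIntegral_sq_primitive {k G : ℝ → ℝ} (hk : Integrable k) {a b : ℝ}
    (hG : ∀ u, G u = G a + ∫ t in a..u, k t) :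
    ∫ u in a..b, G u ^ 2 = b * G b ^ 2 - a * G a ^ 2 - 2 * ∫ u in a..b, u * k u * G u := by
  have hG' : G = fun u => G a + ∫ t in a..u, k t := funext hG
  have hac : AbsolutelyContinuousOnInterval G a b := by
    rw [hG']
    exact (contDiff_const (n := 1)).contDiffOn.absolutelyContinuousOnInterval.add
      (hk.intervalIntegrable.absolutelyContinuousOnInterval_intervalIntegral (by simp))
  have hid : AbsolutelyContinuousOnInterval (fun u : ℝ => u) a b :=
    (contDiff_id (n := 1)).contDiffOn.absolutelyContinuousOnInterval
  have hparts := (hac.fun_mul hac).integral_mul_deriv_eq_deriv_mul hid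
  have hderiv : ∀ᵐ u, HasDerivAt G (k u) u := by
    filter_upwards [LocallyIntegrable.ae_hasDerivAt_integral hk.locallyIntegrable] with u hu
    rw [hG']
    simpa using (hu a).const_add (G a)
  have hleft : ∫ u in a..b, G u ^ 2 = ∫ u in a..b, G u * G u * deriv (fun u : ℝ => u) u := by
    simp [pow_two]
  have hright : ∫ u in a..b, deriv (fun u => G u * G u) u * u
      = 2 * ∫ u in a..b, u * k u * G u := by
    rw [← intervalIntegral.integral_const_mul]
    refine intervalIntegral.integral_congr_ae ?_
    filter_upwards [hderiv] with u hu _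
    rw [(hu.fun_mul hu).deriv]
    ring
  rw [hleft, hparts, hright]
  ring

/-- First-order expansion, with an `O(h ^ 2)` remainder, of the integral of `f` against a bounded
compactly supported profile rescaled to width `h` around `x`. -/
lemma exists_abs_integral_rescaled_mul_sub_le {φ f : ℝ → ℝ} {R L x : ℝ} (hR : 0 < R)
    (hφm : Measurable φ) (hφb : ∀ u, |φ u| ≤ 1) (hφs : ∀ u, R < |u| → φ u = 0)
    (hf : Continuous f) (hL : ∀ t, |t| ≤ 1 → |f (x - t) - f x| ≤ L * |t|) :
    ∃ C, ∀ h, 0 < h → h * R ≤ 1 →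
      |(∫ y, φ ((x - y) / h) * f y) - h * f x * ∫ u, φ u| ≤ C * h ^ 2 := by
  have hL0 : 0 ≤ L := by simpa using (abs_nonneg _).trans (hL 1 (by simp))
  refine ⟨L * R * (2 * R), fun h hh hhR => ?_⟩
  have hsubst : ∫ y, φ ((x - y) / h) * f y = h * ∫ u, φ u * f (x - h * u) := by
    rw [← integral_sub_left_eq_self _ volume x]
    have := Measure.integral_comp_mul_left (fun t => φ (t / h) * f (x - t)) h
    simp only [mul_div_cancel_left₀ _ hh.ne', abs_of_pos (inv_pos.2 hh), smul_eq_mul] at this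
    simp only [sub_sub_cancel, this]
    field_simp
  have hrestrict : ∀ g : ℝ → ℝ, ∫ u, φ u * g u = ∫ u in Icc (-R) R, φ u * g u := fun g => by
    refine (setIntegral_eq_integral_of_forall_compl_eq_zero fun u hu => ?_).symm
    rw [hφs u (not_le.1 fun h => hu (abs_le.1 h)), zero_mul]
  have hintegrable : ∀ g : ℝ → ℝ, Continuous g → IntegrableOn (fun u => φ u * g u) (Icc (-R) R) :=
    fun g hg => (hg.integrableOn_Icc).bdd_mul hφm.aestronglyMeasurable
      (Filter.Eventually.of_forall hφb)
  have hdiff : (∫ u, φ u * f (x - h * u)) - f x * ∫ u, φ u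
      = ∫ u in Icc (-R) R, φ u * (f (x - h * u) - f x) := by
    have h1 : f x * ∫ u, φ u = ∫ u, φ u * f x := by rw [integral_mul_const, mul_comm]
    rw [h1, hrestrict, hrestrict, ← integral_sub (hintegrable _ (by fun_prop))
      (hintegrable _ continuous_const)]
    simp only [mul_sub]
  have hbound : |∫ u in Icc (-R) R, φ u * (f (x - h * u) - f x)| ≤ L * (h * R) * (2 * R) := by
    have := norm_setIntegral_le_of_norm_le_const (μ := volume) (s := Icc (-R) R)
      (f := fun u => φ u * (f (x - h * u) - f x)) (C := L * (h * R)) (by simp) fun u hu => by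
        have hhu : |h * u| ≤ h * R := by
          rw [abs_mul, abs_of_pos hh]
          exact mul_le_mul_of_nonneg_left (abs_le.2 hu) hh.le
        rw [norm_mul]
        calc |φ u| * |f (x - h * u) - f x| ≤ 1 * (L * |h * u|) :=
              mul_le_mul (hφb u) (hL _ (hhu.trans hhR)) (abs_nonneg _) zero_le_one
          _ ≤ L * (h * R) := by rw [one_mul]; gcongr
    rw [Real.volume_real_Icc_of_le (by linarith)] at this
    rw [← Real.norm_eq_abs]
    convert this using 2
    ring
  rw [hsubst, mul_assoc, ← mul_sub, hdiff, abs_mul, abs_of_pos hh]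
  calc _ ≤ h * (L * (h * R) * (2 * R)) := by gcongr
    _ = _ := by ring

/-- A function with continuous derivative is Lipschitz at `x` on the unit ball around `x`. -/
lemma exists_abs_sub_le_of_continuous_deriv {f f' : ℝ → ℝ} (hf : ∀ y, HasDerivAt f (f' y) y)
    (hf' : Continuous f') (x : ℝ) :
    ∃ L, ∀ t, |t| ≤ 1 → |f (x - t) - f x| ≤ L * |t| := by
  obtain ⟨L, hL⟩ := (isCompact_closedBall x 1).exists_bound_of_continuousOn hf'.continuousOn
  refine ⟨L, fun t ht => ?_⟩
  have := (convex_closedBall x 1).norm_image_sub_le_of_norm_hasDerivWithin_le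
    (fun y _ => (hf y).hasDerivWithinAt) hL (Metric.mem_closedBall_self zero_le_one)
    (y := x - t) (by simpa [Real.dist_eq] using ht)
  simpa using this

/-- The squared distance between a compactly supported cdf and the unit step, integrated. -/
lemma integral_sq_cdf_sub_step {k K : ℝ → ℝ} {R : ℝ} (hR : 0 < R) (hk : Integrable k)
    (hks : ∀ u, R < |u| → k u = 0)
    (hK : ∀ a u, K u = K a + ∫ t in a..u, k t) (hKl : ∀ u < -R, K u = 0)
    (hKr : ∀ u, R < u → K u = 1) :
    ∫ u, (K u - if 0 ≤ u then 1 else 0) ^ 2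
      = 2 * ((∫ v in Ioi 0, v * k v) - ∫ v, v * k v * K v) := by
  have hKc : Continuous K := by
    rw [show K = fun u => K 0 + ∫ t in (0 : ℝ)..u, k t from funext (hK 0)]
    exact continuous_const.add (intervalIntegral.continuous_primitive
      (fun _ _ => hk.intervalIntegrable) 0)
  obtain ⟨S, hRS⟩ : ∃ S, R < S := ⟨R + 1, by linarith⟩
  have hS : 0 < S := hR.trans hRS
  have hres : ∀ g : ℝ → ℝ, (∀ u, R < |u| → g u = 0) → ∫ u, g u = ∫ u in (-S)..S, g u :=
    fun g hg => by
      rw [intervalIntegral.integral_of_le (by linarith)]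
      refine (setIntegral_eq_integral_of_forall_compl_eq_zero fun u hu => hg u ?_).symm
      by_contra! h
      have := abs_le.1 h
      exact hu ⟨by linarith, by linarith⟩
  have hvk : ∀ a b : ℝ, IntervalIntegrable (fun v => v * k v) volume a b := fun a b =>
    hk.intervalIntegrable.continuousOn_mul continuousOn_id
  have hvkK : ∀ a b : ℝ, IntervalIntegrable (fun v => v * k v * K v) volume a b := fun a b =>
    (hvk a b).mul_continuousOn hKc.continuousOn
  have he : ∫ v in Ioi 0, v * k v = ∫ v in (0 : ℝ)..S, v * k v := by
    rw [intervalIntegral.integral_of_le hS.le]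
    refine setIntegral_eq_of_subset_of_forall_sdiff_eq_zero measurableSet_Ioi
      Ioc_subset_Ioi_self fun u hu => ?_
    have h0 : 0 < u := hu.1
    have hSu : S < u := by
      by_contra! h
      exact hu.2 ⟨h0, h⟩
    rw [hks u (by rw [abs_of_pos h0]; linarith), mul_zero]
  have hd : ∫ v, v * k v * K v
      = (∫ v in (-S)..0, v * k v * K v) + ∫ v in (0 : ℝ)..S, v * k v * K v := by
    rw [hres _ fun u hu => by rw [hks u hu]; ring,
      intervalIntegral.integral_add_adjacent_intervals (hvkK _ _) (hvkK _ _)]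
  have hneg : ∫ u in (-S)..0, (K u - if 0 ≤ u then 1 else 0) ^ 2 = ∫ u in (-S)..0, K u ^ 2 := by
    refine intervalIntegral.integral_congr_ae ?_
    filter_upwards [Measure.ae_ne volume (0 : ℝ)] with u hu0 hu
    rw [uIoc_of_le (by linarith)] at hu
    rw [if_neg (not_le.2 (lt_of_le_of_ne hu.2 hu0)), sub_zero]
  have hpos : ∫ u in (0 : ℝ)..S, (K u - if 0 ≤ u then 1 else 0) ^ 2
      = ∫ u in (0 : ℝ)..S, (K u - 1) ^ 2 := by
    refine intervalIntegral.integral_congr fun u hu => ?_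
    rw [uIcc_of_le hS.le] at hu
    simp only [if_pos hu.1]
  have hsq : ∫ u, (K u - if 0 ≤ u then 1 else 0) ^ 2
      = (∫ u in (-S)..0, K u ^ 2) + ∫ u in (0 : ℝ)..S, (K u - 1) ^ 2 := by
    rw [hres _ fun u hu => ?_, ← hneg, ← hpos,
      intervalIntegral.integral_add_adjacent_intervals]
    · refine IntervalIntegrable.congr_ae ((hKc.pow 2).intervalIntegrable (-S) 0) ?_
      rw [uIoc_of_le (by linarith)]
      filter_upwards [ae_restrict_of_ae (Measure.ae_ne volume (0 : ℝ)),
        ae_restrict_mem measurableSet_Ioc] with u hu0 hu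
      rw [if_neg (not_le.2 (lt_of_le_of_ne hu.2 hu0)), sub_zero]
      rfl
    · refine IntervalIntegrable.congr (fun u hu => ?_)
        (((hKc.sub continuous_const).pow 2).intervalIntegrable (0 : ℝ) S) (g := fun u =>
          (K u - if 0 ≤ u then 1 else 0) ^ 2) (f := fun u => (K u - 1) ^ 2)
      rw [uIoc_of_le hS.le] at hu
      simp only [if_pos hu.1.le]
    · rcases lt_abs.1 hu with h | h
      · rw [hKr u h, if_pos (by linarith)]; ring
      · rw [hKl u (by linarith), if_neg (by linarith)]; ring
  have hsplit : ∫ u in (0 : ℝ)..S, u * k u * (K u - 1)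
      = (∫ u in (0 : ℝ)..S, u * k u * K u) - ∫ u in (0 : ℝ)..S, u * k u := by
    rw [← intervalIntegral.integral_sub (hvkK _ _) (hvk _ _)]
    simp only [mul_sub, mul_one]
  rw [hsq, intervalIntegral_sq_primitive hk (hK _),
    intervalIntegral_sq_primitive (G := fun u => K u - 1) hk fun u => by rw [hK 0 u]; ring,
    hsplit, he, hd, hKl (-S) (by linarith), hKr S hRS]
  ring

theorem variance_kernel_summand_expansion
    (k K f f' f'' F : ℝ → ℝ) (x : ℝ)
    (hknn : ∀ u, 0 ≤ k u)
    (hksymm : ∀ u, k (-u) = k u)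
    (hkint : Integrable k)
    (hkprob : ∫ v, k v = 1)
    (hksupp : HasCompactSupport k)
    (hK : ∀ u, K u = ∫ v in Iic u, k v)
    (hfnn : ∀ y, 0 ≤ f y)
    (hfint : Integrable f)
    (hfprob : ∫ y, f y = 1)
    (hF : ∀ y, HasDerivAt F (f y) y)
    (hf : ∀ y, HasDerivAt f (f' y) y)
    (hf' : ∀ y, HasDerivAt f' (f'' y) y)
    (hf''cont : Continuous f'')
    (hf''bdd : ∃ M, ∀ y, |f'' y| ≤ M)
    (e₁ d₁ : ℝ)
    (he₁ : e₁ = ∫ v in Ioi 0, v * k v)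
    (hd₁ : d₁ = ∫ v, v * k v * K v)
    (A : ℝ → ℝ → ℝ)
    (hA : ∀ h y, A h y = K ((x - y) / h) - (if y ≤ x then (1 : ℝ) else 0)) :
    ∃ C > 0, ∃ h₀ > 0, ∀ h : ℝ, 0 < h → h < h₀ →
      |(∫ y, (A h y) ^ 2 * f y) - (∫ y, A h y * f y) ^ 2
          - 2 * (e₁ - d₁) * h * f x| ≤ C * h ^ 2 := by
  obtain ⟨R, hR, hks⟩ : ∃ R > 0, ∀ u, R < |u| → k u = 0 := by
    obtain ⟨R, hR, hsub⟩ := hksupp.isCompact.isBounded.subset_closedBall_lt 0 0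
    refine ⟨R, hR, fun u hu => image_eq_zero_of_notMem_tsupport fun hmem => ?_⟩
    have := hsub hmem
    rw [mem_closedBall_zero_iff, Real.norm_eq_abs] at this
    linarith
  have hKprim : ∀ a u, K u = K a + ∫ t in a..u, k t := fun a u => by
    rw [hK, hK, ← intervalIntegral.integral_Iic_sub_Iic hkint.integrableOn hkint.integrableOn]
    ring
  have hKl : ∀ u < -R, K u = 0 := fun u hu => by
    rw [hK]
    refine setIntegral_eq_zero_of_forall_eq_zero fun v hv => hks v ?_
    exact lt_abs.2 (Or.inr (by linarith [mem_Iic.1 hv]))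
  have hKr : ∀ u, R < u → K u = 1 := fun u hu => by
    rw [hK, ← hkprob]
    refine setIntegral_eq_integral_of_forall_compl_eq_zero fun v hv => hks v ?_
    exact lt_abs.2 (Or.inl (hu.trans (not_le.1 hv)))
  have hK0 : ∀ u, 0 ≤ K u := fun u => by
    rw [hK]
    exact integral_nonneg hknn
  have hK1 : ∀ u, K u ≤ 1 := fun u => by
    rw [hK, ← hkprob]
    exact setIntegral_le_integral hkint (Filter.Eventually.of_forall hknn)
  have hKmono : Monotone K := fun u v huv => by
    rw [hKprim u v]
    linarith [intervalIntegral.integral_nonneg_of_forall (μ := volume) huv hknn]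
  set φ : ℝ → ℝ := fun u => K u - if 0 ≤ u then 1 else 0 with hφ
  have hφm : Measurable φ :=
    hKmono.measurable.sub (Measurable.ite measurableSet_Ici measurable_const measurable_const)
  have hφb : ∀ u, |φ u| ≤ 1 := fun u => by
    have h0 := hK0 u
    have h1 := hK1 u
    rw [abs_le]
    simp only [hφ]
    split_ifs <;> constructor <;> linarith
  have hφs : ∀ u, R < |u| → φ u = 0 := fun u hu => by
    simp only [hφ]
    rcases lt_abs.1 hu with h | h
    · rw [hKr u h, if_pos (by linarith), sub_self]
    · rw [hKl u (by linarith), if_neg (by linarith), sub_self]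
  have hAφ : ∀ h, 0 < h → ∀ y, A h y = φ ((x - y) / h) := fun h hh y => by
    rw [hA]
    simp only [hφ, le_div_iff₀ hh, zero_mul, sub_nonneg]
  have hfc : Continuous f := continuous_iff_continuousAt.2 fun y => (hf y).continuousAt
  obtain ⟨L, hL⟩ := exists_abs_sub_le_of_continuous_deriv hf
    (continuous_iff_continuousAt.2 fun y => (hf' y).continuousAt) x
  obtain ⟨C₁, hC₁⟩ := exists_abs_integral_rescaled_mul_sub_le hR hφm hφb hφs hfc hL
  obtain ⟨C₂, hC₂⟩ := exists_abs_integral_rescaled_mul_sub_le hR (φ := fun u => φ u ^ 2)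
    (hφm.pow_const 2) (fun u => by rw [abs_pow]; exact pow_le_one₀ (abs_nonneg _) (hφb u))
    (fun u hu => by simp [hφs u hu]) hfc hL
  have hsq : ∫ u, φ u ^ 2 = 2 * (e₁ - d₁) := by
    rw [he₁, hd₁]
    exact integral_sq_cdf_sub_step hR hkint hks hKprim hKl hKr
  set B := |f x * ∫ u, φ u| + |C₁|
  refine ⟨|C₂| + B ^ 2 + 1, by positivity, min 1 R⁻¹, by positivity, fun h hh hlt => ?_⟩
  have hh1 : h ≤ 1 := hlt.le.trans (min_le_left _ _)
  have hhR : h * R ≤ 1 := by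
    rw [← le_div_iff₀ hR, one_div]
    exact hlt.le.trans (min_le_right _ _)
  simp only [hAφ h hh]
  have hmean : |∫ y, φ ((x - y) / h) * f y| ≤ B * h := by
    have h1 := hC₁ h hh hhR
    have h2 : C₁ * h ^ 2 ≤ |C₁| * h := by
      calc C₁ * h ^ 2 ≤ |C₁| * h ^ 2 := by gcongr; exact le_abs_self _
        _ ≤ |C₁| * h := by gcongr; nlinarith
    have h3 : |h * f x * ∫ u, φ u| = |f x * ∫ u, φ u| * h := by
      rw [mul_assoc, abs_mul, abs_of_pos hh, mul_comm]
    have h4 := abs_sub_abs_le_abs_sub (∫ y, φ ((x - y) / h) * f y) (h * f x * ∫ u, φ u)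
    simp only [B, add_mul]
    linarith
  have hmean2 : (∫ y, φ ((x - y) / h) * f y) ^ 2 ≤ B ^ 2 * h ^ 2 := by
    rw [← mul_pow, ← sq_abs]
    gcongr
  have hmain := hC₂ h hh hhR
  rw [hsq, show h * f x * (2 * (e₁ - d₁)) = 2 * (e₁ - d₁) * h * f x by ring] at hmain
  have hC : C₂ * h ^ 2 ≤ |C₂| * h ^ 2 := by gcongr; exact le_abs_self _
  have hnn := sq_nonneg (∫ y, φ ((x - y) / h) * f y)
  have := abs_le.1 hmain
  rw [abs_le]
  constructor <;> nlinarith [sq_nonneg h, mul_nonneg (sq_nonneg B) (sq_nonneg h)]
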